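/- arXiv:2405.06597 — 2 statements merged into one kernel-verified Lean document; each statement's English description precedes it below -/
import Mathlib

section
/- The vector representation matrices of the two-parameter quantum group of type C_n satisfy the (r,s)-Serre relations: e_i e_j = e_j e_i and f_i f_j = f_j f_i whenever 1 ≤ i, j ≤ n and |i − j| ≥ 2; for 1 ≤ i ≤ n−2: e_i²e_{i+1} − (r+s)e_i e_{i+1} e_i + rs·e_{i+1}e_i² = 0 and e_{i+1}²e_i − (r^{−1}+s^{−1})e_{i+1}e_i e_{i+1} + (rs)^{−1}e_i e_{i+1}² = 0; e_n²e_{n−1} − (r^{−1}+s^{−1})e_n e_{n−1} e_n + (rs)^{−1}e_{n−1}e_n² = 0; e_{n−1}³e_n − (r+ρσ+s)e_{n−1}²e_n e_{n−1} + ρσ(r+ρσ+s)e_{n−1}e_n e_{n−1}² − (ρσ)³e_n e_{n−1}³ = 0; and the analogous relations for the f's: for 1 ≤ i ≤ n−2: f_{i+1}f_i² − (r+s)f_i f_{i+1} f_i + rs·f_i²f_{i+1} = 0 and f_i f_{i+1}² − (r^{−1}+s^{−1})f_{i+1}f_i f_{i+1} + (rs)^{−1}f_{i+1}²f_i = 0;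 f_{n−1}f_n² − (r^{−1}+s^{−1})f_n f_{n−1} f_n + (rs)^{−1}f_n²f_{n−1} = 0; f_n f_{n−1}³ − (r+ρσ+s)f_{n−1}f_n f_{n−1}² + ρσ(r+ρσ+s)f_{n−1}²f_n f_{n−1} − (ρσ)³f_{n−1}³f_n = 0. -/
noncomputable section

open Finset
open scoped Kronecker

set_option maxHeartbeats 1000000

abbrev K : Type := FractionRing (MvPolynomial (Fin 2) ℚ)

def ρ : K := algebraMap (MvPolynomial (Fin 2) ℚ) K (MvPolynomial.X 0)
def σ' : K := algebraMap (MvPolynomial (Fin 2) ℚ) K (MvPolynomial.X 1)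
def r : K := ρ ^ 2
def s : K := σ' ^ 2

abbrev M (n : ℕ) := Matrix (Fin (2*n)) (Fin (2*n)) K
abbrev M2 (n : ℕ) := Matrix (Fin (2*n) × Fin (2*n)) (Fin (2*n) × Fin (2*n)) K

/-- the matrix unit `E_{kl}` (1-based indices). -/
def E (n k l : ℕ) : M n :=
  Matrix.of fun a b => if a.val + 1 = k ∧ b.val + 1 = l then (1 : K) else 0

def eMat (n i : ℕ) : M n :=
  if i = n then (ρ⁻¹ * σ'⁻¹) • E n (n+1) n
  else (ρ⁻¹ * σ'⁻¹) • E n (i+1) i - E n (2*n-i+1) (2*n-i)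

def fMat (n i : ℕ) : M n :=
  if i = n then (ρ⁻¹ * σ'⁻¹) • E n n (n+1)
  else (ρ⁻¹ * σ'⁻¹) • E n i (i+1) - E n (2*n-i) (2*n-i+1)

def ωMat (n i : ℕ) : M n :=
  if i = n then
    ∑ j ∈ Icc 1 (2*n),
      (if j ≤ n - 1 then r * s else if j = n then r⁻¹ * s else if j = n + 1 then r * s⁻¹
       else r⁻¹ * s⁻¹) • E n j j
  else
    ∑ j ∈ Icc 1 (2*n),
      (if j = i then r⁻¹ else if j = i + 1 then s⁻¹ else if j = 2*n - i then s
       else if j = 2*n - i + 1 then r else 1) • E n j j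

def ω'Mat (n i : ℕ) : M n :=
  if i = n then
    ∑ j ∈ Icc 1 (2*n),
      (if j ≤ n - 1 then r * s else if j = n then r * s⁻¹ else if j = n + 1 then r⁻¹ * s
       else r⁻¹ * s⁻¹) • E n j j
  else
    ∑ j ∈ Icc 1 (2*n),
      (if j = i then s⁻¹ else if j = i + 1 then r⁻¹ else if j = 2*n - i then r
       else if j = 2*n - i + 1 then s else 1) • E n j j

theorem E_mul_ne (n k l k' l' : ℕ) (h : l ≠ k') : E n k l * E n k' l' = 0 := by
  ext a b
  simp only [E, Matrix.mul_apply, Matrix.of_apply, Matrix.zero_apply]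
  apply Finset.sum_eq_zero
  intro x _
  split_ifs <;> first | omega | simp

theorem E_tri (n k l k' l' k'' l'' : ℕ) (h : l ≠ k' ∨ l' ≠ k'') :
    E n k l * (E n k' l' * E n k'' l'') = 0 := by
  rcases h with h | h
  · rw [← mul_assoc, E_mul_ne _ _ _ _ _ h, zero_mul]
  · rw [E_mul_ne _ _ _ _ _ h, mul_zero]

theorem e_mul_zero (n i j : ℕ) (hi : 1 ≤ i) (hin : i ≤ n) (hj : 1 ≤ j) (hjn : j ≤ n)
    (h : i + 2 ≤ j ∨ j + 2 ≤ i ∨ i = j) : eMat n i * eMat n j = 0 := by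
  unfold eMat
  split_ifs <;> simp only [sub_mul, mul_sub, smul_mul_assoc, mul_smul_comm] <;>
    (repeat rw [E_mul_ne _ _ _ _ _ (by omega)]) <;> simp

theorem f_mul_zero (n i j : ℕ) (hi : 1 ≤ i) (hin : i ≤ n) (hj : 1 ≤ j) (hjn : j ≤ n)
    (h : i + 2 ≤ j ∨ j + 2 ≤ i ∨ i = j) : fMat n i * fMat n j = 0 := by
  unfold fMat
  split_ifs <;> simp only [sub_mul, mul_sub, smul_mul_assoc, mul_smul_comm] <;>
    (repeat rw [E_mul_ne _ _ _ _ _ (by omega)]) <;> simp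

theorem e_tri_zero (n i j : ℕ) (hi : 1 ≤ i) (hin : i ≤ n) (hj : 1 ≤ j) (hjn : j ≤ n)
    (h : (i + 1 = j ∧ j < n) ∨ j + 1 = i) : eMat n i * eMat n j * eMat n i = 0 := by
  unfold eMat
  rw [mul_assoc]
  split_ifs <;> simp only [sub_mul, mul_sub, smul_mul_assoc, mul_smul_comm] <;>
    (repeat rw [E_tri _ _ _ _ _ _ _ (by omega)]) <;> first | omega | simp

theorem f_tri_zero (n i j : ℕ) (hi : 1 ≤ i) (hin : i ≤ n) (hj : 1 ≤ j) (hjn : j ≤ n)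
    (h : (i + 1 = j ∧ j < n) ∨ j + 1 = i) : fMat n i * fMat n j * fMat n i = 0 := by
  unfold fMat
  rw [mul_assoc]
  split_ifs <;> simp only [sub_mul, mul_sub, smul_mul_assoc, mul_smul_comm] <;>
    (repeat rw [E_tri _ _ _ _ _ _ _ (by omega)]) <;> first | omega | simp

theorem e_sq (n i : ℕ) (hi : 1 ≤ i) (hin : i ≤ n) : eMat n i ^ 2 = 0 := by
  rw [pow_two]; exact e_mul_zero n i i hi hin hi hin (by omega)

theorem f_sq (n i : ℕ) (hi : 1 ≤ i) (hin : i ≤ n) : fMat n i ^ 2 = 0 := by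
  rw [pow_two]; exact f_mul_zero n i i hi hin hi hin (by omega)

theorem e_cu (n i : ℕ) (hi : 1 ≤ i) (hin : i ≤ n) : eMat n i ^ 3 = 0 := by
  rw [pow_succ, e_sq n i hi hin, zero_mul]

theorem f_cu (n i : ℕ) (hi : 1 ≤ i) (hin : i ≤ n) : fMat n i ^ 3 = 0 := by
  rw [pow_succ, f_sq n i hi hin, zero_mul]

/-- the `(r,s)`-Serre relations in the vector representation. -/
theorem stmt2 (n : ℕ) (hn : 2 ≤ n) :
    (∀ i j, 1 ≤ i → i ≤ n → 1 ≤ j → j ≤ n → (i + 2 ≤ j ∨ j + 2 ≤ i) →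
      eMat n i * eMat n j = eMat n j * eMat n i ∧
      fMat n i * fMat n j = fMat n j * fMat n i) ∧
    (∀ i, 1 ≤ i → i ≤ n - 2 →
      eMat n i ^ 2 * eMat n (i+1) - (r + s) • (eMat n i * eMat n (i+1) * eMat n i)
        + (r * s) • (eMat n (i+1) * eMat n i ^ 2) = 0 ∧
      eMat n (i+1) ^ 2 * eMat n i - (r⁻¹ + s⁻¹) • (eMat n (i+1) * eMat n i * eMat n (i+1))
        + (r * s)⁻¹ • (eMat n i * eMat n (i+1) ^ 2) = 0 ∧
      fMat n (i+1) * fMat n i ^ 2 - (r + s) • (fMat n i * fMat n (i+1) * fMat n i)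
        + (r * s) • (fMat n i ^ 2 * fMat n (i+1)) = 0 ∧
      fMat n i * fMat n (i+1) ^ 2 - (r⁻¹ + s⁻¹) • (fMat n (i+1) * fMat n i * fMat n (i+1))
        + (r * s)⁻¹ • (fMat n (i+1) ^ 2 * fMat n i) = 0) ∧
    (eMat n n ^ 2 * eMat n (n-1) - (r⁻¹ + s⁻¹) • (eMat n n * eMat n (n-1) * eMat n n)
      + (r * s)⁻¹ • (eMat n (n-1) * eMat n n ^ 2) = 0) ∧
    (eMat n (n-1) ^ 3 * eMat n n
      - (r + ρ * σ' + s) • (eMat n (n-1) ^ 2 * eMat n n * eMat n (n-1))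
      + (ρ * σ' * (r + ρ * σ' + s)) • (eMat n (n-1) * eMat n n * eMat n (n-1) ^ 2)
      - (ρ * σ') ^ 3 • (eMat n n * eMat n (n-1) ^ 3) = 0) ∧
    (fMat n (n-1) * fMat n n ^ 2 - (r⁻¹ + s⁻¹) • (fMat n n * fMat n (n-1) * fMat n n)
      + (r * s)⁻¹ • (fMat n n ^ 2 * fMat n (n-1)) = 0) ∧
    (fMat n n * fMat n (n-1) ^ 3
      - (r + ρ * σ' + s) • (fMat n (n-1) * fMat n n * fMat n (n-1) ^ 2)
      + (ρ * σ' * (r + ρ * σ' + s)) • (fMat n (n-1) ^ 2 * fMat n n * fMat n (n-1))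
      - (ρ * σ') ^ 3 • (fMat n (n-1) ^ 3 * fMat n n) = 0) := by
  refine ⟨?_, ?_, ?_, ?_, ?_, ?_⟩
  · intro i j hi hin hj hjn h
    rw [e_mul_zero n i j hi hin hj hjn (by omega), e_mul_zero n j i hj hjn hi hin (by omega),
      f_mul_zero n i j hi hin hj hjn (by omega), f_mul_zero n j i hj hjn hi hin (by omega)]
    exact ⟨rfl, rfl⟩
  · intro i hi hin
    rw [e_sq n i (by omega) (by omega), e_sq n (i+1) (by omega) (by omega),
      f_sq n i (by omega) (by omega), f_sq n (i+1) (by omega) (by omega),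
      e_tri_zero n i (i+1) (by omega) (by omega) (by omega) (by omega) (by omega),
      e_tri_zero n (i+1) i (by omega) (by omega) (by omega) (by omega) (by omega),
      f_tri_zero n i (i+1) (by omega) (by omega) (by omega) (by omega) (by omega),
      f_tri_zero n (i+1) i (by omega) (by omega) (by omega) (by omega) (by omega)]
    simp
  · rw [e_sq n n (by omega) (by omega),
      e_tri_zero n n (n-1) (by omega) (by omega) (by omega) (by omega) (by omega)]
    simp
  · rw [e_sq n (n-1) (by omega) (by omega), e_cu n (n-1) (by omega) (by omega)]
    simp
  · rw [f_sq n n (by omega) (by omega),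
      f_tri_zero n n (n-1) (by omega) (by omega) (by omega) (by omega) (by omega)]
    simp
  · rw [f_sq n (n-1) (by omega) (by omega), f_cu n (n-1) (by omega) (by omega)]
    simp

end
end

section
/- The basic R-matrix of type C_n commutes with the tensor squares of the Cartan matrices of the vector representation: for every 1 ≤ i ≤ n, R·(ω_i⊗ω_i) = (ω_i⊗ω_i)·R and R·(ω_i′⊗ω_i′) = (ω_i′⊗ω_i′)·R. -/
noncomputable section

open Finset
open scoped Kronecker

set_option maxHeartbeats 1000000

/-- `ī` for `1 ≤ i ≤ 2n`. -/
def bar (n i : ℕ) : ℤ := if i ≤ n then (n : ℤ) + 1 - i else (n : ℤ) - i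

/-- `ε_i` for `1 ≤ i ≤ 2n`. -/
def sg (n i : ℕ) : K := if i ≤ n then 1 else -1

def S1 (n : ℕ) : M2 n :=
  (∑ i ∈ Icc 1 (n-1), ∑ j ∈ Icc (i+1) n, E n i i ⊗ₖ E n j j)
  + (∑ i ∈ Icc 1 (n-1), ∑ j ∈ Icc (2*n+1-i+1) (2*n), E n i i ⊗ₖ E n j j)
  + (∑ j ∈ Icc (n+2) (2*n), E n n n ⊗ₖ E n j j)
  + (∑ j ∈ Icc (n+1) (2*n-1), ∑ i ∈ Icc (j+1) (2*n), E n i i ⊗ₖ E n j j)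
  + (∑ i ∈ Icc 1 (n-1), ∑ j ∈ Icc (n+1) (2*n-i), E n j j ⊗ₖ E n i i)

def S2 (n : ℕ) : M2 n :=
  (∑ i ∈ Icc 1 (n-1), ∑ j ∈ Icc (i+1) n, E n j j ⊗ₖ E n i i)
  + (∑ i ∈ Icc 1 (n-1), ∑ j ∈ Icc (2*n+1-i+1) (2*n), E n j j ⊗ₖ E n i i)
  + (∑ j ∈ Icc (n+2) (2*n), E n j j ⊗ₖ E n n n)
  + (∑ j ∈ Icc (n+1) (2*n-1), ∑ i ∈ Icc (j+1) (2*n), E n j j ⊗ₖ E n i i)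
  + (∑ i ∈ Icc 1 (n-1), ∑ j ∈ Icc (n+1) (2*n-i), E n i i ⊗ₖ E n j j)

/-- The basic quantum `R`-matrix of type `C_n`. -/
def RMat (n : ℕ) : M2 n :=
  (ρ * σ'⁻¹) • (∑ i ∈ Icc 1 (2*n), E n i i ⊗ₖ E n i i)
  + (ρ⁻¹ * σ') • (∑ i ∈ Icc 1 (2*n), E n i i ⊗ₖ E n (2*n+1-i) (2*n+1-i))
  + (ρ * σ') • S1 n
  + (ρ⁻¹ * σ'⁻¹) • S2 n
  + (ρ * σ'⁻¹ - ρ⁻¹ * σ') •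
      ((∑ i ∈ Icc 1 (2*n), ∑ j ∈ Icc (i+1) (2*n), E n i j ⊗ₖ E n j i)
        - ∑ i ∈ Icc 1 (2*n), ∑ j ∈ Icc 1 (i-1),
            ((ρ * σ'⁻¹) ^ (bar n i - bar n j) * sg n i * sg n j) •
              (E n (2*n+1-i) (2*n+1-j) ⊗ₖ E n i j))

/-- The permutation matrix `P`. -/
def Pmat (n : ℕ) : M2 n := ∑ i ∈ Icc 1 (2*n), ∑ j ∈ Icc 1 (2*n), E n i j ⊗ₖ E n j i

theorem ρ_ne : ρ ≠ 0 := by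
  unfold ρ
  rw [Ne, FaithfulSMul.algebraMap_eq_zero_iff]
  exact MvPolynomial.X_ne_zero 0

theorem σ_ne : σ' ≠ 0 := by
  unfold σ'
  rw [Ne, FaithfulSMul.algebraMap_eq_zero_iff]
  exact MvPolynomial.X_ne_zero 1

theorem r_ne : r ≠ 0 := pow_ne_zero _ ρ_ne
theorem s_ne : s ≠ 0 := pow_ne_zero _ σ_ne

def Dg (n : ℕ) (d : ℕ → K) : M n := Matrix.diagonal fun a => d (a.val + 1)

theorem sum_eq_Dg (n : ℕ) (d : ℕ → K) : ∑ j ∈ Icc 1 (2*n), d j • E n j j = Dg n d := by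
  ext a b
  have ha := a.2
  simp only [Matrix.sum_apply, Matrix.smul_apply, E, Matrix.of_apply, Dg, Matrix.diagonal_apply,
    smul_eq_mul, mul_ite, mul_one, mul_zero]
  by_cases hab : a = b
  · subst hab
    simp only [and_self, if_true]
    rw [Finset.sum_ite_eq, if_pos]
    rw [Finset.mem_Icc]; omega
  · rw [if_neg hab]
    apply Finset.sum_eq_zero
    intro j _
    rw [if_neg]
    rintro ⟨h1, h2⟩
    exact hab (Fin.ext (by omega))

theorem comE (n : ℕ) (d : ℕ → K) (i j k l : ℕ) (h : d i * d k = d j * d l) :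
    Commute (E n i j ⊗ₖ E n k l) (Dg n d ⊗ₖ Dg n d) := by
  unfold Commute SemiconjBy
  rw [← Matrix.mul_kronecker_mul, ← Matrix.mul_kronecker_mul]
  ext ⟨a, b⟩ ⟨a', b'⟩
  simp only [Dg, Matrix.kroneckerMap_apply, Matrix.mul_diagonal, Matrix.diagonal_mul, E,
    Matrix.of_apply]
  by_cases h1 : a.val + 1 = i ∧ a'.val + 1 = j
  · by_cases h2 : b.val + 1 = k ∧ b'.val + 1 = l
    · obtain ⟨rfl, rfl⟩ := h1
      obtain ⟨rfl, rfl⟩ := h2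
      simpa using h.symm
    · simp [h2]
  · simp [h1]

theorem comR (n : ℕ) (d : ℕ → K) (h : ∀ j, 1 ≤ j → j ≤ 2*n → d (2*n+1-j) * d j = 1) :
    Commute (RMat n) (Dg n d ⊗ₖ Dg n d) := by
  have hd : ∀ i k, Commute (E n i i ⊗ₖ E n k k) (Dg n d ⊗ₖ Dg n d) :=
    fun i k => comE n d i i k k rfl
  have hx : ∀ i k, Commute (E n i k ⊗ₖ E n k i) (Dg n d ⊗ₖ Dg n d) :=
    fun i k => comE n d i k k i (mul_comm _ _)
  have h1 : Commute (S1 n) (Dg n d ⊗ₖ Dg n d) := by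
    unfold S1
    refine ((((?_ : Commute _ _).add_left ?_).add_left ?_).add_left ?_).add_left ?_
    all_goals
      refine Commute.sum_left _ _ _ fun i _ => ?_
      first
      | exact hd _ _
      | exact Commute.sum_left _ _ _ fun j _ => hd _ _
  have h2 : Commute (S2 n) (Dg n d ⊗ₖ Dg n d) := by
    unfold S2
    refine ((((?_ : Commute _ _).add_left ?_).add_left ?_).add_left ?_).add_left ?_
    all_goals
      refine Commute.sum_left _ _ _ fun i _ => ?_
      first
      | exact hd _ _
      | exact Commute.sum_left _ _ _ fun j _ => hd _ _
  unfold RMat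
  refine ((((?_ : Commute _ _).add_left ?_).add_left (h1.smul_left _)).add_left
    (h2.smul_left _)).add_left (Commute.smul_left (Commute.sub_left ?_ ?_) _)
  · exact Commute.smul_left (Commute.sum_left _ _ _ fun i _ => hd _ _) _
  · exact Commute.smul_left (Commute.sum_left _ _ _ fun i _ => hd _ _) _
  · exact Commute.sum_left _ _ _ fun i _ => Commute.sum_left _ _ _ fun j _ => hx _ _
  · refine Commute.sum_left _ _ _ fun i hi => Commute.sum_left _ _ _ fun j hj =>
      Commute.smul_left (comE n d _ _ _ _ ?_) _
    rw [Finset.mem_Icc] at hi hj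
    rw [h i hi.1 hi.2, h j hj.1 (by omega)]

theorem comN (n : ℕ) (hn : 2 ≤ n) (u v w x : K) (h1 : u * x = 1) (h2 : v * w = 1) :
    ∀ j, 1 ≤ j → j ≤ 2*n → (fun j => if j ≤ n - 1 then u else if j = n then v
      else if j = n + 1 then w else x) (2*n+1-j) * (fun j => if j ≤ n - 1 then u else if j = n then v
      else if j = n + 1 then w else x) j = 1 := by
  intro j hj1 hj2
  dsimp only
  split_ifs <;> first | omega | assumption | (rw [mul_comm]; assumption)

theorem comI (n i : ℕ) (hi1 : 1 ≤ i) (hi : i < n) (u v w x : K)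
    (h1 : u * x = 1) (h2 : v * w = 1) :
    ∀ j, 1 ≤ j → j ≤ 2*n → (fun j => if j = i then u else if j = i + 1 then v
      else if j = 2*n - i then w else if j = 2*n - i + 1 then x else 1) (2*n+1-j) *
      (fun j => if j = i then u else if j = i + 1 then v
      else if j = 2*n - i then w else if j = 2*n - i + 1 then x else 1) j = 1 := by
  intro j hj1 hj2
  dsimp only
  split_ifs <;> first | omega | assumption | (rw [mul_comm]; assumption) | exact mul_one 1

/-- the basic `R`-matrix commutes with the tensor squares of the Cartan matrices. -/
theorem stmt5 (n : ℕ) (hn : 2 ≤ n) (i : ℕ) (hi1 : 1 ≤ i) (hi2 : i ≤ n) :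
    RMat n * (ωMat n i ⊗ₖ ωMat n i) = (ωMat n i ⊗ₖ ωMat n i) * RMat n ∧
    RMat n * (ω'Mat n i ⊗ₖ ω'Mat n i) = (ω'Mat n i ⊗ₖ ω'Mat n i) * RMat n := by
  have hr := r_ne
  have hs := s_ne
  by_cases hin : i = n
  · constructor
    · rw [ωMat, if_pos hin, sum_eq_Dg n (fun j => if j ≤ n - 1 then r * s else if j = n then r⁻¹ * s
        else if j = n + 1 then r * s⁻¹ else r⁻¹ * s⁻¹)]
      exact comR n _ (comN n hn _ _ _ _ (by field_simp) (by field_simp))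
    · rw [ω'Mat, if_pos hin, sum_eq_Dg n (fun j => if j ≤ n - 1 then r * s else if j = n then r * s⁻¹
        else if j = n + 1 then r⁻¹ * s else r⁻¹ * s⁻¹)]
      exact comR n _ (comN n hn _ _ _ _ (by field_simp) (by field_simp))
  · have hlt : i < n := by omega
    constructor
    · rw [ωMat, if_neg hin, sum_eq_Dg n (fun j => if j = i then r⁻¹ else if j = i + 1 then s⁻¹
        else if j = 2*n - i then s else if j = 2*n - i + 1 then r else 1)]
      exact comR n _ (comI n i hi1 hlt _ _ _ _ (by field_simp) (by field_simp))
    · rw [ω'Mat, if_neg hin, sum_eq_Dg n (fun j => if j = i then s⁻¹ else if j = i + 1 then r⁻¹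
        else if j = 2*n - i then r else if j = 2*n - i + 1 then s else 1)]
      exact comR n _ (comI n i hi1 hlt _ _ _ _ (by field_simp) (by field_simp))

end
end
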